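/- Let H ∈ ℂ^{Nr×Nt} and G ∈ ℂ^{Ne×Nt}, let P_T > 0, and suppose the Hermitian matrix H†H − G†G is NOT negative semidefinite. Then the KKT system of the secrecy rate maximization problem admits at most one solution in Q; that is, if (Q₁, Z₁, λ₁) and (Q₂, Z₂, λ₂) both satisfy: H†(I + H Qᵢ H†)⁻¹ H − G†(I + G Qᵢ G†)⁻¹ G − λᵢ I + Zᵢ = 0, tr(Qᵢ) ≤ P_T, λᵢ ≥ 0, λᵢ(tr(Qᵢ) − P_T) = 0, Zᵢ ⪰ 0, Qᵢ ⪰ 0, Qᵢ Zᵢ = 0 (for i = 1, 2), then Q₁ = Q₂. -/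

import Mathlib

open Matrix
open scoped ComplexOrder

/-- The KKT conditions of the secrecy rate maximization problem
`max { ln det(I + H Q Hᴴ) − ln det(I + G Q Gᴴ) : Q ⪰ 0, tr Q ≤ P_T }`:
stationarity, primal feasibility, dual feasibility and complementary slackness. -/
def IsKKTPoint {Nr Ne Nt : ℕ}
    (H : Matrix (Fin Nr) (Fin Nt) ℂ) (G : Matrix (Fin Ne) (Fin Nt) ℂ) (PT : ℝ)
    (Q Z : Matrix (Fin Nt) (Fin Nt) ℂ) (l : ℝ) : Prop :=
  Hᴴ * (1 + H * Q * Hᴴ)⁻¹ * H - Gᴴ * (1 + G * Q * Gᴴ)⁻¹ * G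
      - (l : ℂ) • (1 : Matrix (Fin Nt) (Fin Nt) ℂ) + Z = 0 ∧
    (Matrix.trace Q).re ≤ PT ∧
    0 ≤ l ∧
    l * ((Matrix.trace Q).re - PT) = 0 ∧
    Z.PosSemidef ∧
    Q.PosSemidef ∧
    Q * Z = 0

section PosSemidef

variable {n : Type*} [Fintype n] [DecidableEq n]

/-- A positive definite matrix of trace at most its size and of determinant at least one is the
identity: equality case of the inequality between arithmetic and geometric means. -/
lemma Matrix.PosDef.eq_one_of_trace_le_of_one_le_det {T : Matrix n n ℂ} (hT : T.PosDef)
    (htr : T.trace.re ≤ Fintype.card n) (hdet : 1 ≤ T.det) : T = 1 := by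
  have hpos := hT.eigenvalues_pos
  have hprod : 1 ≤ ∏ i, hT.1.eigenvalues i := by
    rw [hT.1.det_eq_prod_eigenvalues, ← RCLike.ofReal_prod] at hdet
    exact (Complex.le_def.1 hdet).1
  have hsum : ∑ i, hT.1.eigenvalues i ≤ Fintype.card n := by
    rw [hT.1.trace_eq_sum_eigenvalues] at htr
    simpa using htr
  have hlog : 0 ≤ ∑ i, Real.log (hT.1.eigenvalues i) := by
    rw [← Real.log_prod fun i _ => (hpos i).ne']
    exact Real.log_nonneg hprod
  have hnonneg : ∀ i ∈ Finset.univ,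
      0 ≤ hT.1.eigenvalues i - 1 - Real.log (hT.1.eigenvalues i) := fun i _ => by
    linarith [Real.log_le_sub_one_of_pos (hpos i)]
  have hzero : ∑ i, (hT.1.eigenvalues i - 1 - Real.log (hT.1.eigenvalues i)) = 0 := by
    refine le_antisymm ?_ (Finset.sum_nonneg hnonneg)
    simp only [Finset.sum_sub_distrib, Finset.sum_const, Finset.card_univ, nsmul_eq_mul, mul_one]
    linarith
  have heig : ∀ i, hT.1.eigenvalues i = 1 := fun i => by
    by_contra hi
    have h := (Finset.sum_eq_zero_iff_of_nonneg hnonneg).1 hzero i (Finset.mem_univ i)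
    linarith [Real.log_lt_sub_one_of_pos (hpos i) hi]
  have hfun : (RCLike.ofReal ∘ hT.1.eigenvalues : n → ℂ) = 1 := by
    ext i
    simp [heig i]
  have hspec := hT.1.spectral_theorem
  rw [hfun] at hspec
  simpa using hspec

lemma Matrix.PosSemidef.one_le_det_one_add {Y : Matrix n n ℂ} (hY : Y.PosSemidef) :
    1 ≤ (1 + Y).det := by
  have hT : (1 + Y).PosDef := PosDef.one.add_posSemidef hY
  have heig : ∀ i, 1 ≤ hT.1.eigenvalues i := fun i => by
    have hmem : hT.1.eigenvalues i - 1 + (1 : ℝ) ∈ spectrum ℝ (algebraMap ℝ _ 1 + Y) := by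
      simpa using hT.1.eigenvalues_mem_spectrum_real i
    rw [spectrum.add_mem_add_iff, hY.1.spectrum_real_eq_range_eigenvalues] at hmem
    obtain ⟨j, hj⟩ := hmem
    linarith [hY.eigenvalues_nonneg j]
  rw [hT.1.det_eq_prod_eigenvalues, ← RCLike.ofReal_prod]
  exact Complex.real_le_real.2 (Finset.one_le_prod fun i _ => heig i)

open scoped MatrixOrder in
lemma Matrix.PosSemidef.one_le_det_one_add_mul {Z R : Matrix n n ℂ} (hZ : Z.PosSemidef)
    (hR : R.PosSemidef) : 1 ≤ (1 + Z * R).det := by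
  obtain ⟨Y, rfl⟩ := CStarAlgebra.nonneg_iff_eq_star_mul_self.mp hZ.nonneg
  rw [Matrix.mul_assoc, det_one_add_mul_comm]
  exact (hR.mul_mul_conjTranspose_same Y).one_le_det_one_add

end PosSemidef

section Resolvent

variable {m n : Type*} [Fintype m] [DecidableEq m] [Fintype n]

lemma posDef_one_add_mul_mul_conjTranspose (G : Matrix m n ℂ) {S : Matrix n n ℂ}
    (hS : S.PosSemidef) : (1 + G * S * Gᴴ).PosDef :=
  PosDef.one.add_posSemidef (hS.mul_mul_conjTranspose_same G)

lemma posSemidef_resolvent (G : Matrix m n ℂ) {S : Matrix n n ℂ} (hS : S.PosSemidef) :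
    (Gᴴ * (1 + G * S * Gᴴ)⁻¹ * G).PosSemidef :=
  (posDef_one_add_mul_mul_conjTranspose G hS).inv.posSemidef.conjTranspose_mul_mul_same G

variable [DecidableEq n]

lemma det_one_add_gram_mul_pos (G : Matrix m n ℂ) {S : Matrix n n ℂ}
    (hS : S.PosSemidef) : 0 < (1 + Gᴴ * G * S).det := by
  rw [Matrix.mul_assoc, det_one_add_mul_comm]
  exact (posDef_one_add_mul_mul_conjTranspose G hS).det_pos

lemma one_add_gram_mul_resolvent (G : Matrix m n ℂ) {S : Matrix n n ℂ} (hS : S.PosSemidef) :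
    (1 + Gᴴ * G * S) * (Gᴴ * (1 + G * S * Gᴴ)⁻¹ * G) = Gᴴ * G := by
  have hu := (isUnit_iff_isUnit_det _).1 (posDef_one_add_mul_mul_conjTranspose G hS).isUnit
  have h : (1 + Gᴴ * G * S) * Gᴴ = Gᴴ * (1 + G * S * Gᴴ) := by
    simp only [Matrix.add_mul, Matrix.mul_add, Matrix.one_mul, Matrix.mul_one, Matrix.mul_assoc]
  rw [← Matrix.mul_assoc, ← Matrix.mul_assoc, h, Matrix.mul_assoc Gᴴ, mul_nonsing_inv _ hu,
    Matrix.mul_one]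

lemma resolvent_mul_one_add_mul_gram (G : Matrix m n ℂ) {S : Matrix n n ℂ} (hS : S.PosSemidef) :
    (Gᴴ * (1 + G * S * Gᴴ)⁻¹ * G) * (1 + S * (Gᴴ * G)) = Gᴴ * G := by
  have h := congrArg conjTranspose (one_add_gram_mul_resolvent G hS)
  rw [conjTranspose_mul, (posSemidef_resolvent G hS).1.eq] at h
  simpa [conjTranspose_mul, Matrix.mul_assoc, hS.1.eq] using h

/-- If `N (1 + S B) = B`, then `S - S N S = S (1 + B S)⁻¹` is positive semidefinite. -/
lemma posSemidef_sub_mul_mul {B S N : Matrix n n ℂ} (hB : B.PosSemidef) (hS : S.PosSemidef)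
    (hN : N.PosSemidef) (hr : N * (1 + S * B) = B) :
    (S - S * N * S).PosSemidef := by
  have hSBS : (S + S * B * S).PosSemidef := by
    simpa [hS.1.eq] using hS.add (hB.mul_mul_conjTranspose_same S)
  have h := hSBS.mul_mul_conjTranspose_same (1 - S * N)
  have hct : (1 - S * N)ᴴ = 1 - N * S := by simp [conjTranspose_mul, hS.1.eq, hN.1.eq]
  have hfac : (1 - S * N) * (S + S * B * S) * (1 - N * S) = S - S * N * S := by
    have h1 : (1 - S * N) * (S + S * B * S) = S := by
      calc (1 - S * N) * (S + S * B * S)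
          = S + S * B * S - S * (N * (1 + S * B)) * S := by noncomm_ring
        _ = S := by rw [hr]; noncomm_ring
    rw [h1]; noncomm_ring
  rwa [hct, hfac] at h

lemma sub_mul_mul_mul_one_add {B S N : Matrix n n ℂ} (hr : N * (1 + S * B) = B) :
    (S - S * N * S) * (1 + B * S) = S := by
  calc (S - S * N * S) * (1 + B * S) = S + S * B * S - S * (N * (1 + S * B)) * S := by noncomm_ring
    _ = S := by rw [hr]; noncomm_ring

end Resolvent

section Comparison

variable {n : Type*} [Fintype n] [DecidableEq n]

/-- Let `C - B = l (1 + C Q) (1 + Q B)` with `l > 0`. Among the positive semidefinite `S` with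
`tr S ≤ tr Q`, the ratio `det (1 + C S) / det (1 + B S)` is maximal only at `S = Q`. -/
lemma eq_of_det_mul_det_le {B C Q S N : Matrix n n ℂ} {l : ℝ} (hl : 0 < l)
    (hB : B.PosSemidef) (hC : C.PosSemidef) (hQ : Q.PosSemidef) (hS : S.PosSemidef)
    (hN : N.PosSemidef) (hNl : (1 + B * S) * N = B) (hNr : N * (1 + S * B) = B)
    (hCB : C - B = (l : ℂ) • ((1 + C * Q) * (1 + Q * B)))
    (htr : S.trace.re ≤ Q.trace.re)
    (hCQ : 0 < (1 + C * Q).det) (hBS : 0 < (1 + B * S).det)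
    (hdet : (1 + C * Q).det * (1 + B * S).det ≤ (1 + C * S).det * (1 + B * Q).det) :
    S = Q := by
  have hl' : (0 : ℂ) < l := by exact_mod_cast hl
  have hCB' : C - B = (l : ℂ) • ((1 + B * Q) * (1 + Q * C)) := by
    have h := congrArg conjTranspose hCB
    simpa [conjTranspose_mul, hB.1.eq, hC.1.eq, hQ.1.eq] using h
  set R := S - S * N * S with hRdef
  have hR : R.PosSemidef := posSemidef_sub_mul_mul hB hS hN hNr
  have hRS : R * (1 + B * S) = S := sub_mul_mul_mul_one_add hNr
  set X : Matrix n n ℂ := 1 - (l : ℂ) • (Q + Q * B * Q) with hX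
  have hCX : (1 + C * Q) * X = 1 + B * Q := by
    calc (1 + C * Q) * X
        = 1 + C * Q - ((l : ℂ) • ((1 + C * Q) * (1 + Q * B))) * Q := by
          simp only [hX, smul_mul_assoc, mul_sub, mul_smul_comm]
          noncomm_ring
      _ = 1 + B * Q := by rw [← hCB]; noncomm_ring
  have hXpos : X.PosDef := by
    have hY : (1 + (l : ℂ) • (Q + Q * C * Q)).PosDef := by
      refine PosDef.one.add_posSemidef (PosSemidef.smul ?_ hl'.le)
      simpa [hQ.1.eq] using hQ.add (hC.mul_mul_conjTranspose_same Q)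
    have hBY : (1 + B * Q) * (1 + (l : ℂ) • (Q + Q * C * Q)) = 1 + C * Q := by
      calc (1 + B * Q) * (1 + (l : ℂ) • (Q + Q * C * Q))
          = 1 + B * Q + ((l : ℂ) • ((1 + B * Q) * (1 + Q * C))) * Q := by
            simp only [smul_mul_assoc, mul_add, mul_smul_comm]
            noncomm_ring
        _ = 1 + C * Q := by rw [← hCB']; noncomm_ring
    have hXY : X * (1 + (l : ℂ) • (Q + Q * C * Q)) = 1 := by
      have hu : IsUnit (1 + C * Q) := (isUnit_iff_isUnit_det _).2 hCQ.ne'.isUnit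
      apply hu.mul_left_cancel
      rw [← Matrix.mul_assoc, hCX, hBY, Matrix.mul_one]
    rw [← inv_eq_left_inv hXY]
    exact hY.inv
  set T := X + (l : ℂ) • ((1 + Q * B) * R * (1 + B * Q)) with hT
  have hTpos : T.PosDef := by
    refine hXpos.add_posSemidef (PosSemidef.smul ?_ hl'.le)
    have h := hR.mul_mul_conjTranspose_same (1 + Q * B)
    simpa [conjTranspose_mul, hQ.1.eq, hB.1.eq] using h
  have hCT : (1 + C * Q) * T = (1 + (C - B) * R) * (1 + B * Q) := by
    calc (1 + C * Q) * T
        = (1 + C * Q) * X + ((l : ℂ) • ((1 + C * Q) * (1 + Q * B))) * R * (1 + B * Q) := by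
          simp only [hT, smul_mul_assoc, mul_add (1 + C * Q) X, mul_smul_comm, Matrix.mul_assoc]
      _ = (1 + (C - B) * R) * (1 + B * Q) := by rw [hCX, ← hCB]; noncomm_ring
  have hCS : (1 + (C - B) * R) * (1 + B * S) = 1 + C * S := by
    calc (1 + (C - B) * R) * (1 + B * S)
        = 1 + B * S + (C - B) * (R * (1 + B * S)) := by noncomm_ring
      _ = 1 + C * S := by rw [hRS]; noncomm_ring
  have hTdet : 1 ≤ T.det := by
    have h1 := congrArg det hCT
    have h2 := congrArg det hCS
    rw [det_mul, det_mul] at h1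
    rw [det_mul] at h2
    have h3 : (1 + C * Q).det * (1 + B * S).det * T.det
        = (1 + C * S).det * (1 + B * Q).det := by
      rw [← h2]; linear_combination (1 + B * S).det * h1
    rw [← h3] at hdet
    exact le_of_mul_le_mul_left (by simpa using hdet) (mul_pos hCQ hBS)
  have hRB : R * B = S * N := by
    calc R * B = S * B - S * (N * (1 + S * B)) + S * N := by rw [hRdef]; noncomm_ring
      _ = S * N := by rw [hNr]; noncomm_ring
  have hBR : B * R = N * S := by
    calc B * R = B * S - ((1 + B * S) * N) * S + N * S := by rw [hRdef]; noncomm_ring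
      _ = N * S := by rw [hNl]; noncomm_ring
  have hBRB : B * R * B = B - N := by
    calc B * R * B = N * (1 + S * B) - N := by rw [hBR]; noncomm_ring
      _ = B - N := by rw [hNr]
  have hTform : T = 1 + (l : ℂ) • (S - Q - (S - Q) * N * (S - Q)) := by
    have h : (1 + Q * B) * R * (1 + B * Q) = Q + Q * B * Q + (S - Q - (S - Q) * N * (S - Q)) := by
      calc (1 + Q * B) * R * (1 + B * Q)
          = R + Q * (B * R) + R * B * Q + Q * (B * R * B) * Q := by noncomm_ring
        _ = _ := by rw [hBRB, hBR, hRB, hRdef]; noncomm_ring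
    rw [hT, hX, h, smul_add (l : ℂ) (Q + Q * B * Q)]
    abel
  have hTtr : T.trace.re ≤ Fintype.card n := by
    have hpsd : ((S - Q) * N * (S - Q)).PosSemidef := by
      have h := hN.mul_mul_conjTranspose_same (S - Q)
      simpa [hS.1.eq, hQ.1.eq] using h
    have h0 : 0 ≤ ((S - Q) * N * (S - Q)).trace.re := (Complex.le_def.1 hpsd.trace_nonneg).1
    rw [hTform]
    simp only [trace_add, trace_one, trace_smul, trace_sub, smul_eq_mul, Complex.add_re,
      Complex.natCast_re, Complex.re_ofReal_mul, Complex.sub_re]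
    nlinarith
  have hT1 := hTpos.eq_one_of_trace_le_of_one_le_det hTtr hTdet
  have hD : S - Q - (S - Q) * N * (S - Q) = 0 := by
    rw [hTform, add_eq_left, smul_eq_zero] at hT1
    exact hT1.resolve_left hl'.ne'
  have hBQ : IsUnit (1 + B * Q) := by
    rw [← hCX]
    exact ((isUnit_iff_isUnit_det _).2 hCQ.ne'.isUnit).mul hXpos.isUnit
  have hinv : (1 + B * S) * (1 - N * (S - Q)) = 1 + B * Q := by
    calc (1 + B * S) * (1 - N * (S - Q))
        = 1 + B * S - ((1 + B * S) * N) * (S - Q) := by noncomm_ring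
      _ = 1 + B * Q := by rw [hNl]; noncomm_ring
  have hu : IsUnit (1 - N * (S - Q)) := by
    rw [← ((isUnit_iff_isUnit_det _).2 hBS.ne'.isUnit).unit_spec] at hinv
    exact (Units.isUnit_units_mul _ _).1 (hinv ▸ hBQ)
  refine sub_eq_zero.1 (hu.mul_left_eq_zero.1 ?_)
  rw [← hD]
  noncomm_ring

end Comparison

namespace IsKKTPoint

variable {Nr Ne Nt : ℕ} {H : Matrix (Fin Nr) (Fin Nt) ℂ} {G : Matrix (Fin Ne) (Fin Nt) ℂ}
  {PT : ℝ} {Q Z : Matrix (Fin Nt) (Fin Nt) ℂ} {l : ℝ}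

lemma slack_mul_eq_zero (h : IsKKTPoint H G PT Q Z l) : Z * Q = 0 := by
  obtain ⟨-, -, -, -, hZ, hQ, hQZ⟩ := h
  simpa [conjTranspose_mul, hZ.1.eq, hQ.1.eq] using congrArg conjTranspose hQZ

/-- Stationarity with the inverses cleared. -/
lemma gram_sub_gram (h : IsKKTPoint H G PT Q Z l) :
    Hᴴ * H + Z - Gᴴ * G
      = (l : ℂ) • ((1 + (Hᴴ * H + Z) * Q) * (1 + Q * (Gᴴ * G))) := by
  have hZQ := h.slack_mul_eq_zero
  obtain ⟨hst, -, -, -, hZ, hQ, hQZ⟩ := h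
  have hH := one_add_gram_mul_resolvent H hQ
  have hG := resolvent_mul_one_add_mul_gram G hQ
  set M := Hᴴ * (1 + H * Q * Hᴴ)⁻¹ * H
  set N := Gᴴ * (1 + G * Q * Gᴴ)⁻¹ * G
  set A := Hᴴ * H
  set B := Gᴴ * G
  have hZZ : (1 + A * Q) * Z * (1 + Q * B) = Z := by
    calc (1 + A * Q) * Z * (1 + Q * B)
        = Z + A * (Q * Z) + (Z * Q) * B + A * (Q * Z) * Q * B := by noncomm_ring
      _ = Z := by rw [hQZ, hZQ]; noncomm_ring
  have hkey : (1 + A * Q) * (M - N - (l : ℂ) • 1 + Z) * (1 + Q * B) = 0 := by rw [hst]; simp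
  have hexp : (1 + A * Q) * (M - N - (l : ℂ) • 1 + Z) * (1 + Q * B)
      = ((1 + A * Q) * M) * (1 + Q * B) - (1 + A * Q) * (N * (1 + Q * B))
        - (l : ℂ) • ((1 + A * Q) * (1 + Q * B)) + (1 + A * Q) * Z * (1 + Q * B) := by
    simp only [mul_add (1 + A * Q) _ Z, mul_sub, add_mul _ _ (1 + Q * B), sub_mul, mul_smul_comm,
      smul_mul_assoc, mul_one, Matrix.mul_assoc]
  have hZQ' : (A + Z) * Q = A * Q := by rw [add_mul, hZQ, add_zero]
  rw [hexp, hH, hG, hZZ] at hkey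
  rw [hZQ', ← sub_eq_zero, ← hkey]
  noncomm_ring

lemma multiplier_pos (h : IsKKTPoint H G PT Q Z l)
    (hnd : ¬ (-(Hᴴ * H - Gᴴ * G)).PosSemidef) : 0 < l := by
  refine lt_of_le_of_ne h.2.2.1 fun hl => hnd ?_
  have hs := h.gram_sub_gram
  rw [← hl, Complex.ofReal_zero, zero_smul] at hs
  have hZ : -(Hᴴ * H - Gᴴ * G) = Z := by
    rw [← sub_eq_zero, ← neg_eq_zero, ← hs]
    abel
  rw [hZ]
  exact h.2.2.2.2.1

lemma trace_eq (h : IsKKTPoint H G PT Q Z l)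
    (hnd : ¬ (-(Hᴴ * H - Gᴴ * G)).PosSemidef) : Q.trace.re = PT :=
  sub_eq_zero.1 ((mul_eq_zero.1 h.2.2.2.1).resolve_left (h.multiplier_pos hnd).ne')

/-- A KKT point has a strictly larger secrecy rate than every other feasible point. -/
lemma eq_of_det_mul_det_le (h : IsKKTPoint H G PT Q Z l)
    (hnd : ¬ (-(Hᴴ * H - Gᴴ * G)).PosSemidef) {S : Matrix (Fin Nt) (Fin Nt) ℂ}
    (hS : S.PosSemidef) (htr : S.trace.re ≤ PT)
    (hdet : (1 + Hᴴ * H * Q).det * (1 + Gᴴ * G * S).det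
      ≤ (1 + Hᴴ * H * S).det * (1 + Gᴴ * G * Q).det) : S = Q := by
  have hZ : Z.PosSemidef := h.2.2.2.2.1
  have hQ : Q.PosSemidef := h.2.2.2.2.2.1
  have hA := posSemidef_conjTranspose_mul_self H
  have hB := posSemidef_conjTranspose_mul_self G
  have hCQ : (1 + (Hᴴ * H + Z) * Q).det = (1 + Hᴴ * H * Q).det := by
    rw [add_mul, h.slack_mul_eq_zero, add_zero]
  have hCS : (1 + Hᴴ * H * S).det ≤ (1 + (Hᴴ * H + Z) * S).det := by
    have hr := resolvent_mul_one_add_mul_gram H hS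
    have hN := posSemidef_resolvent H hS
    set N := Hᴴ * (1 + H * S * Hᴴ)⁻¹ * H
    have hfac : 1 + (Hᴴ * H + Z) * S
        = (1 + Z * (S - S * N * S)) * (1 + Hᴴ * H * S) := by
      rw [add_mul 1 (Z * _), Matrix.mul_assoc Z, sub_mul_mul_mul_one_add hr]
      noncomm_ring
    rw [hfac, det_mul]
    exact le_mul_of_one_le_left (det_one_add_gram_mul_pos H hS).le
      (hZ.one_le_det_one_add_mul (posSemidef_sub_mul_mul hA hS hN hr))
  refine _root_.eq_of_det_mul_det_le (h.multiplier_pos hnd) hB (hA.add hZ) hQ hS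
    (posSemidef_resolvent G hS) (one_add_gram_mul_resolvent G hS)
    (resolvent_mul_one_add_mul_gram G hS) h.gram_sub_gram (htr.trans_eq (h.trace_eq hnd).symm)
    (hCQ ▸ det_one_add_gram_mul_pos H hQ) (det_one_add_gram_mul_pos G hS) ?_
  rw [hCQ]
  exact hdet.trans (mul_le_mul_of_nonneg_right hCS (det_one_add_gram_mul_pos G hQ).le)

end IsKKTPoint

/-- If `HᴴH − GᴴG` is not negative semidefinite, the KKT system of
the secrecy rate maximization problem admits at most one solution in `Q`. -/
theorem stmt_0 {Nr Ne Nt : ℕ}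
    (H : Matrix (Fin Nr) (Fin Nt) ℂ) (G : Matrix (Fin Ne) (Fin Nt) ℂ)
    (PT : ℝ) (hPT : 0 < PT)
    (hnd : ¬ (-(Hᴴ * H - Gᴴ * G)).PosSemidef)
    (Q₁ Z₁ : Matrix (Fin Nt) (Fin Nt) ℂ) (l₁ : ℝ)
    (Q₂ Z₂ : Matrix (Fin Nt) (Fin Nt) ℂ) (l₂ : ℝ)
    (h₁ : IsKKTPoint H G PT Q₁ Z₁ l₁)
    (h₂ : IsKKTPoint H G PT Q₂ Z₂ l₂) :
    Q₁ = Q₂ := by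
  have hQ₁ : Q₁.PosSemidef := h₁.2.2.2.2.2.1
  have hQ₂ : Q₂.PosSemidef := h₂.2.2.2.2.2.1
  have hreal : ∀ x y : ℂ, 0 < x → 0 < y → x ≤ y ∨ y ≤ x := fun x y hx hy => by
    have him : x.im = y.im := (Complex.lt_def.1 hx).2.symm.trans (Complex.lt_def.1 hy).2
    simpa [Complex.le_def, him] using le_total x.re y.re
  rcases hreal _ _
    (mul_pos (det_one_add_gram_mul_pos H hQ₁) (det_one_add_gram_mul_pos G hQ₂))
    (mul_pos (det_one_add_gram_mul_pos H hQ₂) (det_one_add_gram_mul_pos G hQ₁)) with h | h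
  · exact (h₁.eq_of_det_mul_det_le hnd hQ₂ h₂.2.1 h).symm
  · exact h₂.eq_of_det_mul_det_le hnd hQ₁ h₁.2.1 h
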